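/- Let H ∈ (1/2,1), c > 0 and s < t be real numbers. Let B be a finite set, B' ⊆ B, let Δ be a partition of B with no singleton blocks and p a pairing of B with (Δ,p) connected. Let Δ' and p' be the restrictions of Δ and p to B', and assume: Δ' has no singleton blocks, every pair of p is either contained in B' or disjoint from B' (so p' is a pairing of B'), and (Δ',p') is connected as a pair of partitions of B'. Then there exists a constant C (depending on H, c, s, t, B, Δ, p but not on ε) such that for all ε ∈ (0,1]: J̃^ε(Δ,p) ≤ C · J̃^ε(Δ',p'). -/

import Mathlib

open MeasureTheory Finset

variable {α : Type*} [DecidableEq α]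

/-- `Δ` is a partition of the finite set `B`. -/
def IsPartitionOf (B : Finset α) (Δ : Finset (Finset α)) : Prop :=
  (∀ b ∈ Δ, b.Nonempty) ∧ Δ.sup id = B ∧
    ∀ b ∈ Δ, ∀ c ∈ Δ, b ≠ c → Disjoint b c

/-- The pair of partitions `(Δ, p)` of `B` is connected, i.e. `Δ ∨ p = {B}`. -/
def ConnectedPair (B : Finset α) (Δ p : Finset (Finset α)) : Prop :=
  ∀ S ⊆ B, (∀ b ∈ Δ, b ⊆ S ∨ Disjoint b S) → (∀ b ∈ p, b ⊆ S ∨ Disjoint b S) →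
    S = ∅ ∨ S = B

/-- Extend a function indexed by the subtype `↥B` to all of `α` by zero. -/
noncomputable def extendBy (B : Finset α) (r : {x // x ∈ B} → ℝ) (a : α) : ℝ :=
  if h : a ∈ B then r ⟨a, h⟩ else 0

/-- For a two-element set `q = {a, b}`, this is `|r a - r b|`. -/
noncomputable def pairGap (r : α → ℝ) (q : Finset α) : ℝ :=
  if h : q.Nonempty then q.sup' h r - q.inf' h r else 0

/-- The cumulant integral
`J̃^ε(Δ,p) = ε^{σ(Δ)(H−1/2)+|B|/2} ∫_{[s/ε,t/ε]^B} ∏_{A ∈ Δ, |A|≥2} e^{−c Σ_{i,j∈A}|r_i−r_j|}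
  ∏_{{a,b}∈p} |r_a−r_b|^{2H−2} dr^B`,
where `σ(Δ)` is the number of singleton blocks of `Δ`. -/
noncomputable def Jtilde (H c s t ε : ℝ) (B : Finset α) (Δ p : Finset (Finset α)) : ℝ :=
  ε ^ ((((Δ.filter fun A => A.card = 1).card : ℝ)) * (H - 1 / 2) + (B.card : ℝ) / 2) *
    ∫ r : {x // x ∈ B} → ℝ in Set.univ.pi fun _ => Set.Icc (s / ε) (t / ε),
      (∏ A ∈ Δ.filter fun A => 2 ≤ A.card,
        Real.exp (-c * ∑ i ∈ A, ∑ j ∈ A, |extendBy B r i - extendBy B r j|)) *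
      ∏ q ∈ p, pairGap (extendBy B r) q ^ (2 * H - 2)


/-- Restriction of a partition to a subset: the nonempty intersections of the
blocks with the subset. -/
def restrictPart (Δ : Finset (Finset α)) (S : Finset α) : Finset (Finset α) :=
  (Δ.image (fun b => b ∩ S)).filter (fun b => b.Nonempty)

open scoped ENNReal

/-- Integrating out the variables of `W` first: a uniform bound on the marginal of `f` factors out
as soon as `g` does not depend on these variables. -/
theorem lmarginal_union_mul_le {ν : Measure ℝ} [SigmaFinite ν] {W R : Finset α}
    (hWR : Disjoint W R) {f g : (α → ℝ) → ℝ≥0∞} (hf : Measurable f) (hg : Measurable g)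
    {M : ℝ≥0∞} (hM : ∀ r, (∫⋯∫⁻_W, f ∂(fun _ => ν)) r ≤ M)
    (hgW : ∀ x y : α → ℝ, (∀ i ∉ W, x i = y i) → g x = g y) (r : α → ℝ) :
    (∫⋯∫⁻_(W ∪ R), (fun x => f x * g x) ∂(fun _ => ν)) r ≤
      M * (∫⋯∫⁻_R, g ∂(fun _ => ν)) r := by
  rw [lmarginal_union' _ (fun x => f x * g x) (hf.mul hg) hWR]
  calc _ ≤ (∫⋯∫⁻_R, (fun x => M * g x) ∂(fun _ => ν)) r := by
        refine lmarginal_mono (fun x => ?_) r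
        have : (∫⋯∫⁻_W, (fun x => f x * g x) ∂(fun _ => ν)) x =
            (∫⋯∫⁻_W, f ∂(fun _ => ν)) x * g x := by
          unfold lmarginal
          refine Eq.trans ?_ (lintegral_mul_const _ (hf.comp measurable_updateFinset))
          refine lintegral_congr fun y => ?_
          exact congrArg (f (Function.updateFinset x W y) * ·)
            (hgW _ _ fun i hi => by simp [Function.updateFinset, hi])
        rw [this]
        gcongr
        exact hM x
    _ = _ := by
        unfold lmarginal
        exact lintegral_const_mul _ (hg.comp measurable_updateFinset)

theorem lmarginal_prod_sub_le {ι : Type*} {ν : Measure ℝ} [SigmaFinite ν] (hν : ν ≤ volume)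
    {κ : ℝ → ℝ≥0∞} (hκ : Measurable κ) {u v : ι → α} (s : Finset ι)
    (hu : Set.InjOn u s) (hv : ∀ i ∈ s, ∀ j ∈ s, v i ≠ u j) (r : α → ℝ) :
    (∫⋯∫⁻_(s.image u), (fun x => ∏ i ∈ s, κ (x (u i) - x (v i))) ∂(fun _ => ν)) r ≤
      (∫⁻ x, κ x) ^ #s := by
  classical
  induction s using Finset.induction_on generalizing r with
  | empty => simp
  | insert a s ha ih =>
    have hsub : (s : Set ι) ⊆ (insert a s : Finset ι) := by simp
    have hua : ∀ i ∈ s, u i ≠ u a := fun i hi h =>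
      ha (hu (by simp [hi]) (by simp) h ▸ hi)
    simp_rw [Finset.prod_insert ha]
    rw [Finset.image_insert, Finset.insert_eq, Finset.card_insert_of_notMem ha, pow_succ']
    refine (lmarginal_union_mul_le (f := fun x => κ (x (u a) - x (v a)))
      (g := fun x => ∏ i ∈ s, κ (x (u i) - x (v i))) (M := ∫⁻ x, κ x) ?_ (by fun_prop)
      (by fun_prop) ?_ ?_ r).trans ?_
    · simpa using hua
    · intro x
      rw [lmarginal_singleton]
      have hva : v a ≠ u a := hv a (by simp) a (by simp)
      simp only [Function.update_self, Function.update_of_ne hva]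
      exact (lintegral_mono' hν le_rfl).trans_eq (lintegral_sub_right_eq_self κ _)
    · intro x y hxy
      refine Finset.prod_congr rfl fun i hi => ?_
      rw [hxy _ (by simpa using hua i hi),
        hxy _ (by simpa using hv i (by simp [hi]) a (by simp))]
    · gcongr
      exact ih (hu.mono hsub) (fun i hi j hj => hv i (by simp [hi]) j (by simp [hj])) r

theorem lmarginal_one {ν : Measure ℝ} [SigmaFinite ν] (R : Finset α) (r : α → ℝ) :
    (∫⋯∫⁻_R, (fun _ => 1) ∂(fun _ => ν)) r = ν Set.univ ^ #R := by
  simp [lmarginal, Measure.pi_univ]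

/-- At least half of the elements of `V` can be sent to a companion that has not been selected. -/
theorem exists_companions {N : α → Finset α} (V : Finset α)
    (hN : ∀ i ∈ V, i ∈ N i) (hNN : ∀ i ∈ V, ∀ j ∈ N i, N j = N i)
    (hN2 : ∀ i ∈ V, ∃ j ∈ N i, j ≠ i) :
    ∃ W ⊆ V, ∃ σ : α → α, (∀ a ∈ W, σ a ∈ N a ∧ σ a ∉ W) ∧ #V ≤ 2 * #W := by
  obtain rfl | ⟨i₀, hi₀⟩ := V.eq_empty_or_nonempty
  · exact ⟨∅, by simp, id, by simp, by simp⟩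
  have : Nonempty α := ⟨i₀⟩
  have hrep : ∀ A : Finset α, A.Nonempty → ∃ a, a ∈ A := fun _ h => h
  choose! rep hrep using hrep
  choose! other hother hne using hN2
  have hext : ∀ A : Finset α, ¬ A ⊆ V → ∃ b, b ∈ A ∧ b ∉ V := fun A h => Finset.not_subset.mp h
  choose! ext hextA hextV using hext
  have hrepN : ∀ i ∈ V, rep (N i) ∈ N i := fun i hi => hrep _ ⟨i, hN i hi⟩
  set S := V.filter fun a => N a ⊆ V ∧ rep (N a) = a with hS
  refine ⟨V \ S, Finset.sdiff_subset, fun a => if N a ⊆ V then rep (N a) else ext (N a), ?_, ?_⟩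
  · intro a ha
    have haV : a ∈ V := (Finset.mem_sdiff.mp ha).1
    dsimp only
    split_ifs with h
    · have h1 := hNN a haV _ (hrepN a haV)
      refine ⟨hrepN a haV, fun hmem => (Finset.mem_sdiff.mp hmem).2 ?_⟩
      simp [hS, h1, h, h (hrepN a haV)]
    · exact ⟨hextA _ h, fun hmem => hextV _ h (Finset.mem_sdiff.mp hmem).1⟩
  · have hcard : #S ≤ #(V \ S) := by
      refine Finset.card_le_card_of_injOn other (fun a ha => ?_) fun a ha b hb hab => ?_
      · obtain ⟨haV, hsub, hra⟩ : a ∈ V ∧ N a ⊆ V ∧ rep (N a) = a := by simpa [hS] using ha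
        simp only [Finset.coe_sdiff, Set.mem_sdiff, Finset.mem_coe, hS, Finset.mem_filter,
          hNN a haV _ (hother a haV), hra]
        exact ⟨hsub (hother a haV), fun h => hne a haV h.2.2.symm⟩
      · obtain ⟨haV, -, hra⟩ : a ∈ V ∧ N a ⊆ V ∧ rep (N a) = a := by simpa [hS] using ha
        obtain ⟨hbV, -, hrb⟩ : b ∈ V ∧ N b ⊆ V ∧ rep (N b) = b := by simpa [hS] using hb
        rw [← hra, ← hrb, ← hNN a haV _ (hother a haV), hab, hNN b hbV _ (hother b hbV)]
    have := Finset.card_sdiff_add_card_eq_card (show S ⊆ V from Finset.filter_subset _ V)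
    omega

theorem lmarginal_finset_sum {ι : Type*} {ν : Measure ℝ} (s : Finset ι)
    {f : ι → (α → ℝ) → ℝ≥0∞} (hf : ∀ i ∈ s, Measurable (f i)) (D : Finset α) (r : α → ℝ) :
    (∫⋯∫⁻_D, (fun x => ∑ i ∈ s, f i x) ∂(fun _ => ν)) r =
      ∑ i ∈ s, (∫⋯∫⁻_D, f i ∂(fun _ => ν)) r :=
  lintegral_finsetSum _ fun i hi => (hf i hi).comp measurable_updateFinset

theorem lmarginal_le_of_companions {N : α → Finset α} {D : Finset α} {P Q : Finset (Finset α)}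
    {u v : Finset α → α}
    (hN : ∀ i ∈ D, i ∈ N i) (hNN : ∀ i ∈ D, ∀ j ∈ N i, N j = N i)
    (hN2 : ∀ i ∈ D, ∃ j ∈ N i, j ≠ i)
    (hD : D = P.biUnion id) (hQ : Q ⊆ P) (huv : ∀ q ∈ P, q = {u q, v q}) (hne : ∀ q ∈ P, u q ≠ v q)
    (hdisj : (P : Set (Finset α)).PairwiseDisjoint id)
    {ν : Measure ℝ} [SigmaFinite ν] (hν : ν ≤ volume)
    {κ₁ κ₂ : ℝ → ℝ≥0∞} (hκ₁ : Measurable κ₁) (hκ₂ : Measurable κ₂) {M τ : ℝ≥0∞}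
    (hM₁ : ∫⁻ x, κ₁ x ≤ M) (hM₂ : ∫⁻ x, κ₂ x ≤ M) (hM : 1 ≤ M)
    (hντ : ν Set.univ ≤ τ) (hτ : 1 ≤ τ) {G : (α → ℝ) → ℝ≥0∞}
    (hG : ∀ W ⊆ D, ∀ σ : α → α, (∀ a ∈ W, σ a ∈ N a) → ∀ r, G r ≤ ∏ a ∈ W, κ₁ (r a - r (σ a)))
    (r : α → ℝ) :
    (∫⋯∫⁻_D, (fun x => G x * ∏ q ∈ Q, κ₂ (x (u q) - x (v q))) ∂(fun _ => ν)) r ≤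
      M ^ (2 * #P) * τ ^ #P := by
  have huq : ∀ q ∈ P, u q ∈ q := fun q hq => by
    exact (Finset.ext_iff.mp (huv q hq) _).mpr (by simp)
  have hvq : ∀ q ∈ P, v q ∈ q := fun q hq => by
    exact (Finset.ext_iff.mp (huv q hq) _).mpr (by simp)
  have hcardq : ∀ q ∈ P, #(id q) = 2 := fun q hq => by
    rw [id, huv q hq]; exact Finset.card_pair (hne q hq)
  have heq : ∀ q ∈ P, ∀ q' ∈ P, ∀ a, a ∈ q → a ∈ q' → q = q' := fun q hq q' hq' a ha ha' => by
    by_contra h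
    exact Finset.disjoint_left.mp (hdisj hq hq' h) ha ha'
  have hcardD : #D = 2 * #P := by
    rw [hD, Finset.card_biUnion (fun q hq q' hq' h => hdisj hq hq' h), Finset.sum_congr rfl hcardq]
    simp [mul_comm]
  have hqD : ∀ q ∈ P, q ⊆ D := fun q hq => hD ▸ Finset.subset_biUnion_of_mem id hq
  set V := (P \ Q).biUnion id with hV
  have hVP : ∀ q ∈ P \ Q, q ∈ P := fun q hq => (Finset.mem_sdiff.mp hq).1
  have hVD : V ⊆ D := Finset.biUnion_subset.mpr fun q hq => hqD q (hVP q hq)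
  have hcardV : #V = 2 * #(P \ Q) := by
    rw [hV, Finset.card_biUnion (fun q hq q' hq' h => hdisj (hVP q hq) (hVP q' hq') h),
      Finset.sum_congr rfl fun q hq => hcardq q (hVP q hq)]
    simp [mul_comm]
  have hVQ : ∀ q ∈ Q, ∀ a ∈ q, a ∉ V := fun q hq a ha haV => by
    obtain ⟨q', hq', haq'⟩ := Finset.mem_biUnion.mp haV
    exact (Finset.mem_sdiff.mp hq').2 (heq q (hQ hq) q' (hVP q' hq') a ha haq' ▸ hq)
  obtain ⟨W, hWV, σ, hσ, hcardW⟩ := exists_companions V (fun i hi => hN i (hVD hi))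
    (fun i hi => hNN i (hVD hi)) (fun i hi => hN2 i (hVD hi))
  have huinj : Set.InjOn u Q := fun q hq q' hq' h =>
    heq q (hQ hq) q' (hQ hq') (u q) (huq q (hQ hq)) (h ▸ huq q' (hQ hq'))
  have hWU : Disjoint W (Q.image u) := by
    simp only [Finset.disjoint_left, Finset.mem_image, not_exists, not_and]
    rintro a ha q hq rfl
    exact hVQ q hq _ (huq q (hQ hq)) (hWV ha)
  have hUD : Q.image u ⊆ D := by
    simp only [Finset.subset_iff, Finset.mem_image]
    rintro a ⟨q, hq, rfl⟩
    exact hqD q (hQ hq) (huq q (hQ hq))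
  set R := D \ (W ∪ Q.image u) with hR
  have hWUD : W ∪ Q.image u ⊆ D := Finset.union_subset (hWV.trans hVD) hUD
  have hDeq : D = W ∪ (Q.image u ∪ R) := by
    rw [← Finset.union_assoc, hR, Finset.union_sdiff_of_subset hWUD]
  have hRdisj : Disjoint (W ∪ Q.image u) R := Finset.disjoint_sdiff
  rw [Finset.disjoint_union_left] at hRdisj
  have hcardR : #W + #Q + #R = 2 * #P := by
    rw [← hcardD, ← Finset.card_image_of_injOn huinj, ← Finset.card_union_of_disjoint hWU, add_comm]
    exact Finset.card_sdiff_add_card_eq_card hWUD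
  have hcardPQ := Finset.card_sdiff_add_card_eq_card hQ
  calc _ ≤ (∫⋯∫⁻_D, (fun x => (∏ a ∈ W, κ₁ (x a - x (σ a))) *
        ∏ q ∈ Q, κ₂ (x (u q) - x (v q))) ∂(fun _ => ν)) r := by
        refine lmarginal_mono (fun x => ?_) r
        dsimp only
        gcongr
        exact hG W (hWV.trans hVD) σ (fun a ha => (hσ a ha).1) x
    _ ≤ M ^ #W * (∫⋯∫⁻_(Q.image u ∪ R), (fun x => (∏ q ∈ Q, κ₂ (x (u q) - x (v q))) * 1)
        ∂(fun _ => ν)) r := by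
        simp only [mul_one]
        conv_lhs => rw [hDeq]
        refine lmarginal_union_mul_le (f := fun x => ∏ a ∈ W, κ₁ (x a - x (σ a)))
          (by rw [Finset.disjoint_union_right]; exact ⟨hWU, hRdisj.1⟩) (by fun_prop) (by fun_prop)
          (fun x => ?_) (fun x y hxy => ?_) r
        · refine le_trans ?_ (pow_le_pow_left' hM₁ _)
          simpa using lmarginal_prod_sub_le hν hκ₁ (u := id) (v := σ) W Function.injective_id.injOn
            (fun i hi j hj h => (hσ i hi).2 (h ▸ hj)) x
        · refine Finset.prod_congr rfl fun q hq => ?_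
          rw [hxy _ fun h => hVQ q hq _ (huq q (hQ hq)) (hWV h),
            hxy _ fun h => hVQ q hq _ (hvq q (hQ hq)) (hWV h)]
    _ ≤ M ^ #W * (M ^ #Q * (∫⋯∫⁻_R, (fun _ => 1) ∂(fun _ => ν)) r) := by
        gcongr
        refine lmarginal_union_mul_le (g := fun _ => 1) hRdisj.2 (by fun_prop) (by fun_prop)
          (fun x => ?_) (fun x y hxy => rfl) r
        refine (lmarginal_prod_sub_le hν hκ₂ Q huinj (fun q hq q' hq' h => ?_) x).trans
          (pow_le_pow_left' hM₂ _)
        have := heq q (hQ hq) q' (hQ hq') _ (hvq q (hQ hq)) (h ▸ huq q' (hQ hq'))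
        subst this
        exact hne q (hQ hq) h.symm
    _ ≤ M ^ (#W + #Q) * τ ^ #R := by
        rw [lmarginal_one, ← mul_assoc, ← pow_add]
        gcongr
    _ ≤ M ^ (2 * #P) * τ ^ #P := by
        gcongr <;> first | assumption | omega

/-- The block of `Δ` containing `i`. -/
def blockOf (Δ : Finset (Finset α)) (i : α) : Finset α :=
  (Δ.filter fun A => i ∈ A).sup id

namespace IsPartitionOf

variable {B B' : Finset α} {Δ : Finset (Finset α)}

theorem eq_of_mem (h : IsPartitionOf B Δ) {A A' : Finset α} (hA : A ∈ Δ) (hA' : A' ∈ Δ) {i : α}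
    (hi : i ∈ A) (hi' : i ∈ A') : A = A' := by
  by_contra hne
  exact Finset.disjoint_left.mp (h.2.2 A hA A' hA' hne) hi hi'

theorem subset (h : IsPartitionOf B Δ) {A : Finset α} (hA : A ∈ Δ) : A ⊆ B :=
  h.2.1 ▸ Finset.le_sup (f := id) hA

theorem exists_mem (h : IsPartitionOf B Δ) {i : α} (hi : i ∈ B) : ∃ A ∈ Δ, i ∈ A := by
  rw [← h.2.1, Finset.mem_sup] at hi
  simpa using hi

theorem pairwiseDisjoint (h : IsPartitionOf B Δ) : (Δ : Set (Finset α)).PairwiseDisjoint id :=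
  fun A hA A' hA' hne => h.2.2 A hA A' hA' hne

theorem blockOf_eq (h : IsPartitionOf B Δ) {A : Finset α} (hA : A ∈ Δ) {i : α} (hi : i ∈ A) :
    blockOf Δ i = A := by
  have : (Δ.filter fun A => i ∈ A) = {A} := by
    ext A'
    simp only [Finset.mem_filter, Finset.mem_singleton]
    exact ⟨fun h' => h.eq_of_mem h'.1 hA h'.2 hi, fun h' => h' ▸ ⟨hA, hi⟩⟩
  simp [blockOf, this]

theorem sum_sum_eq (h : IsPartitionOf B Δ) (f : α → Finset α → ℝ) :
    ∑ A ∈ Δ, ∑ i ∈ A, f i A = ∑ i ∈ B, f i (blockOf Δ i) := by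
  have hB : B = Δ.biUnion id := by rw [← h.2.1, Finset.sup_eq_biUnion]
  conv_rhs => rw [hB, Finset.sum_biUnion h.pairwiseDisjoint]
  exact Finset.sum_congr rfl fun A hA => Finset.sum_congr rfl fun i hi => by
    rw [h.blockOf_eq hA hi]

theorem restrict (h : IsPartitionOf B Δ) (hB' : B' ⊆ B) :
    IsPartitionOf B' (restrictPart Δ B') := by
  simp only [IsPartitionOf, restrictPart, Finset.mem_filter, Finset.mem_image]
  refine ⟨fun b hb => hb.2, ?_, ?_⟩
  · ext i
    simp only [Finset.mem_sup, Finset.mem_filter, Finset.mem_image, id]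
    constructor
    · rintro ⟨_, ⟨⟨A, -, rfl⟩, -⟩, hi⟩
      exact (Finset.mem_inter.mp hi).2
    · intro hi
      obtain ⟨A, hA, hiA⟩ := h.exists_mem (hB' hi)
      have := Finset.mem_inter.mpr ⟨hiA, hi⟩
      exact ⟨_, ⟨⟨A, hA, rfl⟩, ⟨i, this⟩⟩, this⟩
  · rintro _ ⟨⟨A, hA, rfl⟩, -⟩ _ ⟨⟨A', hA', rfl⟩, -⟩ hne
    exact (h.2.2 A hA A' hA' fun h => hne (h ▸ rfl)).mono Finset.inter_subset_left
      Finset.inter_subset_left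

theorem blockOf_restrict_subset (h : IsPartitionOf B Δ) (hB' : B' ⊆ B) {i : α} (hi : i ∈ B') :
    blockOf (restrictPart Δ B') i ⊆ blockOf Δ i := by
  obtain ⟨A, hA, hiA⟩ := h.exists_mem (hB' hi)
  have hmem : i ∈ A ∩ B' := Finset.mem_inter.mpr ⟨hiA, hi⟩
  rw [h.blockOf_eq hA hiA, (h.restrict hB').blockOf_eq (A := A ∩ B') ?_ hmem]
  · exact Finset.inter_subset_left
  · simp only [restrictPart, Finset.mem_filter, Finset.mem_image]
    exact ⟨⟨A, hA, rfl⟩, i, hmem⟩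

end IsPartitionOf

theorem restrictPart_eq_filter {p : Finset (Finset α)} {B' : Finset α}
    (hne : ∀ q ∈ p, q.Nonempty) (hsplit : ∀ q ∈ p, q ⊆ B' ∨ Disjoint q B') :
    restrictPart p B' = p.filter (· ⊆ B') := by
  ext A
  simp only [restrictPart, Finset.mem_filter, Finset.mem_image]
  constructor
  · rintro ⟨⟨q, hq, rfl⟩, hA⟩
    obtain h | h := hsplit q hq
    · rw [Finset.inter_eq_left.mpr h]
      exact ⟨hq, h⟩
    · rw [Finset.disjoint_iff_inter_eq_empty.mp h] at hA
      simp at hA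
  · rintro ⟨hA, hAB⟩
    exact ⟨⟨A, hA, Finset.inter_eq_left.mpr hAB⟩, hne A hA⟩

theorem pairGap_pair (r : α → ℝ) (a b : α) : pairGap r {a, b} = |r a - r b| := by
  rw [pairGap, dif_pos (by simp), Finset.sup'_insert (by simp), Finset.inf'_insert (by simp)]
  simp [max_sub_min_eq_abs']

theorem pairGap_nonneg (r : α → ℝ) (q : Finset α) : 0 ≤ pairGap r q := by
  unfold pairGap
  split_ifs with h
  · obtain ⟨a, ha⟩ := h
    exact sub_nonneg.mpr ((Finset.inf'_le r ha).trans (Finset.le_sup' r ha))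
  · exact le_rfl

theorem measurable_pairGap {q : Finset α} (hq : #q = 2) :
    Measurable fun r : α → ℝ => pairGap r q := by
  obtain ⟨a, b, -, rfl⟩ := Finset.card_eq_two.mp hq
  simp_rw [pairGap_pair]
  fun_prop

theorem lintegral_comp_abs_le {f : ℝ → ℝ≥0∞} (hf : Measurable f) :
    ∫⁻ x, f |x| ≤ 2 * ∫⁻ x in Set.Ici 0, f x := by
  set g := (Set.Ici (0 : ℝ)).indicator f with hg
  have hgm : Measurable g := hf.indicator measurableSet_Ici
  calc ∫⁻ x, f |x| ≤ ∫⁻ x, (g x + g (-x)) := by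
        refine lintegral_mono fun x => ?_
        rcases le_total 0 x with h | h
        · simp [hg, abs_of_nonneg h, h]
        · simp [hg, abs_of_nonpos h, h]
    _ = 2 * ∫⁻ x in Set.Ici 0, f x := by
        rw [lintegral_add_left hgm, lintegral_neg_eq_self, hg,
          lintegral_indicator measurableSet_Ici, two_mul]

theorem lintegral_exp_neg_mul_abs_lt_top {c : ℝ} (hc : 0 < c) :
    ∫⁻ x : ℝ, ENNReal.ofReal (Real.exp (-c * |x|)) < ⊤ := by
  refine (lintegral_comp_abs_le (f := fun y => ENNReal.ofReal (Real.exp (-c * y)))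
    (by fun_prop)).trans_lt (ENNReal.mul_lt_top (by simp) ?_)
  rw [setLIntegral_congr (Ioi_ae_eq_Ici (a := (0 : ℝ))).symm]
  exact (exp_neg_integrableOn_Ioi 0 hc).lintegral_lt_top

/-- The part of the kernel `|x| ^ γ` close to its singularity. -/
noncomputable def truncatedKernel (γ : ℝ) (x : ℝ) : ℝ≥0∞ :=
  (Set.Iic (1 : ℝ)).indicator (fun y => ENNReal.ofReal (y ^ γ)) |x|

theorem measurable_truncatedKernel (γ : ℝ) : Measurable (truncatedKernel γ) := by
  have : Measurable ((Set.Iic (1 : ℝ)).indicator fun y => ENNReal.ofReal (y ^ γ)) :=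
    Measurable.indicator (by fun_prop) measurableSet_Iic
  exact this.comp (by fun_prop)

theorem lintegral_truncatedKernel_lt_top {γ : ℝ} (hγ : -1 < γ) :
    ∫⁻ x, truncatedKernel γ x < ⊤ := by
  refine (lintegral_comp_abs_le (f := (Set.Iic (1 : ℝ)).indicator fun y => ENNReal.ofReal (y ^ γ))
    (Measurable.indicator (by fun_prop) measurableSet_Iic)).trans_lt
    (ENNReal.mul_lt_top (by simp) ?_)
  rw [setLIntegral_congr (Ioi_ae_eq_Ici (a := (0 : ℝ))).symm,
    setLIntegral_indicator measurableSet_Iic, Set.Iic_inter_Ioi]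
  have := (intervalIntegrable_iff_integrableOn_Ioc_of_le zero_le_one).mp
    (intervalIntegral.intervalIntegrable_rpow' (a := 0) (b := 1) hγ)
  exact this.lintegral_lt_top

theorem ofReal_abs_rpow_le {γ : ℝ} (hγ : γ ≤ 0) (x : ℝ) :
    ENNReal.ofReal (|x| ^ γ) ≤ 1 + truncatedKernel γ x := by
  rcases le_or_gt |x| 1 with h | h
  · simp [truncatedKernel, h]
  · exact le_add_right (ENNReal.ofReal_le_one.mpr (Real.rpow_le_one_of_one_le_of_nonpos h.le hγ))

/-- The integrand of `Jtilde`, written with the exponential weights of the variables in `D` towards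
their companions `N i` and the kernels of the pairs in `P`. -/
noncomputable def cumulantWeight (c γ : ℝ) (N : α → Finset α) (D : Finset α)
    (P : Finset (Finset α)) (r : α → ℝ) : ℝ≥0∞ :=
  ENNReal.ofReal (Real.exp (-c * ∑ i ∈ D, ∑ j ∈ N i, |r i - r j|)) *
    ∏ q ∈ P, ENNReal.ofReal (pairGap r q ^ γ)

theorem measurable_cumulantWeight {c γ : ℝ} {N : α → Finset α} {D : Finset α}
    {P : Finset (Finset α)} (hP : ∀ q ∈ P, #q = 2) : Measurable (cumulantWeight c γ N D P) := by
  refine Measurable.mul (by fun_prop) (Finset.measurable_prod _ fun q hq => ?_)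
  exact ((measurable_pairGap (hP q hq)).pow_const γ).ennreal_ofReal

theorem ofReal_exp_neg_sum_le {c : ℝ} (hc : 0 < c) {N : α → Finset α} {W D : Finset α}
    (hWD : W ⊆ D) {σ : α → α} (hσ : ∀ a ∈ W, σ a ∈ N a) (r : α → ℝ) :
    ENNReal.ofReal (Real.exp (-c * ∑ i ∈ D, ∑ j ∈ N i, |r i - r j|)) ≤
      ∏ a ∈ W, ENNReal.ofReal (Real.exp (-c * |r a - r (σ a)|)) := by
  rw [← ENNReal.ofReal_prod_of_nonneg fun _ _ => (Real.exp_pos _).le, ← Real.exp_sum,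
    ← Finset.mul_sum]
  refine ENNReal.ofReal_le_ofReal (Real.exp_le_exp.mpr ?_)
  refine mul_le_mul_of_nonpos_left ?_ (by linarith)
  calc _ ≤ ∑ a ∈ W, ∑ j ∈ N a, |r a - r j| := Finset.sum_le_sum fun a ha =>
        Finset.single_le_sum (f := fun j => |r a - r j|) (fun j _ => abs_nonneg _) (hσ a ha)
    _ ≤ _ := Finset.sum_le_sum_of_subset_of_nonneg hWD fun i _ _ =>
        Finset.sum_nonneg fun j _ => abs_nonneg _

/-- The uniform bound on the integral over the variables in `D`, the other ones being frozen. -/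
theorem exists_lmarginal_cumulantWeight_le {c γ s t : ℝ} (hc : 0 < c) (hγ : -1 < γ) (hγ0 : γ ≤ 0)
    (hst : s < t) {B D : Finset α} {Δ P : Finset (Finset α)} (hΔ : IsPartitionOf B Δ)
    (hΔsing : ∀ b ∈ Δ, #b ≠ 1) (hDB : D ⊆ B) (hDP : D = P.biUnion id) (hpair : ∀ q ∈ P, #q = 2)
    (hdisj : (P : Set (Finset α)).PairwiseDisjoint id) :
    ∃ M : ℝ≥0∞, M ≠ ⊤ ∧ ∀ ε ∈ Set.Ioc (0 : ℝ) 1, ∀ r : α → ℝ,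
      (∫⋯∫⁻_D, cumulantWeight c γ (blockOf Δ) D P
        ∂(fun _ => volume.restrict (Set.Icc (s / ε) (t / ε)))) r ≤
        M * ENNReal.ofReal (1 / ε) ^ #P := by
  obtain rfl | ⟨q₀, hq₀⟩ := P.eq_empty_or_nonempty
  · exact ⟨1, by simp, fun ε _ r => by simp [hDP, cumulantWeight]⟩
  have hα : Nonempty α := (Finset.card_pos.mp (by simp [hpair q₀ hq₀] : 0 < #q₀)).to_type
  have huv : ∀ q ∈ P, ∃ a b, a ≠ b ∧ q = {a, b} := fun q hq => Finset.card_eq_two.mp (hpair q hq)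
  choose! u v hne huv using huv
  have hN : ∀ i ∈ D, i ∈ blockOf Δ i := fun i hi => by
    obtain ⟨A, hA, hiA⟩ := hΔ.exists_mem (hDB hi)
    rwa [hΔ.blockOf_eq hA hiA]
  have hNN : ∀ i ∈ D, ∀ j ∈ blockOf Δ i, blockOf Δ j = blockOf Δ i := fun i hi j hj => by
    obtain ⟨A, hA, hiA⟩ := hΔ.exists_mem (hDB hi)
    rw [hΔ.blockOf_eq hA hiA] at hj ⊢
    exact hΔ.blockOf_eq hA hj
  have hN2 : ∀ i ∈ D, ∃ j ∈ blockOf Δ i, j ≠ i := fun i hi => by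
    obtain ⟨A, hA, hiA⟩ := hΔ.exists_mem (hDB hi)
    rw [hΔ.blockOf_eq hA hiA]
    refine Finset.exists_mem_ne ?_ i
    have := hΔsing A hA
    have : 0 < #A := Finset.card_pos.mpr ⟨i, hiA⟩
    omega
  set κ₁ : ℝ → ℝ≥0∞ := fun x => ENNReal.ofReal (Real.exp (-c * |x|)) with hκ₁
  set M₀ : ℝ≥0∞ := max 1 (max (∫⁻ x, κ₁ x) (∫⁻ x, truncatedKernel γ x)) with hM₀
  have hM₀top : M₀ ≠ ⊤ := by
    have h₁ : ∫⁻ x, κ₁ x ≠ ⊤ := (lintegral_exp_neg_mul_abs_lt_top hc).ne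
    have h₂ := (lintegral_truncatedKernel_lt_top hγ).ne
    simp [hM₀, h₁, h₂]
  refine ⟨2 ^ #P * (M₀ ^ (2 * #P) * ENNReal.ofReal (1 + (t - s)) ^ #P), by finiteness, ?_⟩
  rintro ε ⟨hε0, hε1⟩ r
  set ν : Measure ℝ := volume.restrict (Set.Icc (s / ε) (t / ε)) with hν
  set τ : ℝ≥0∞ := ENNReal.ofReal ((1 + (t - s)) * (1 / ε)) with hτ
  have hε : 1 ≤ 1 / ε := by rwa [le_div_iff₀ hε0, one_mul]
  have hτ1 : 1 ≤ τ := by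
    rw [hτ, ENNReal.one_le_ofReal]
    nlinarith
  have hντ : ν Set.univ ≤ τ := by
    rw [hν, Measure.restrict_apply_univ, Real.volume_Icc, hτ]
    refine ENNReal.ofReal_le_ofReal ?_
    rw [← sub_div, div_eq_mul_one_div]
    gcongr
    linarith
  set G : (α → ℝ) → ℝ≥0∞ := fun r =>
    ENNReal.ofReal (Real.exp (-c * ∑ i ∈ D, ∑ j ∈ blockOf Δ i, |r i - r j|)) with hG
  have hGm : Measurable G := by fun_prop
  have hκ₂ := measurable_truncatedKernel γ
  calc _ ≤ (∫⋯∫⁻_D, (fun x => ∑ Q ∈ P.powerset,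
        G x * ∏ q ∈ Q, truncatedKernel γ (x (u q) - x (v q))) ∂(fun _ => ν)) r := by
        refine lmarginal_mono (fun x => ?_) r
        dsimp only
        rw [← Finset.mul_sum, ← Finset.prod_one_add]
        refine mul_le_mul_right (Finset.prod_le_prod' fun q hq => ?_) _
        rw [huv q hq, pairGap_pair, ← huv q hq]
        exact ofReal_abs_rpow_le hγ0 _
    _ = ∑ Q ∈ P.powerset, (∫⋯∫⁻_D, (fun x => G x *
        ∏ q ∈ Q, truncatedKernel γ (x (u q) - x (v q))) ∂(fun _ => ν)) r :=
        lmarginal_finset_sum _ (fun Q _ => by fun_prop) D r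
    _ ≤ ∑ Q ∈ P.powerset, M₀ ^ (2 * #P) * τ ^ #P := by
        refine Finset.sum_le_sum fun Q hQ => ?_
        exact lmarginal_le_of_companions hN hNN hN2 hDP (Finset.mem_powerset.mp hQ) huv hne hdisj
          Measure.restrict_le_self (κ₁ := κ₁) (by fun_prop) hκ₂
          ((le_max_left _ _).trans (le_max_right _ _)) ((le_max_right _ _).trans (le_max_right _ _))
          (le_max_left _ _) hντ hτ1 (fun W hW σ hσ x => ofReal_exp_neg_sum_le hc hW hσ x) r
    _ = _ := by
        rw [Finset.sum_const, Finset.card_powerset, hτ,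
          ENNReal.ofReal_mul (by linarith), mul_pow, nsmul_eq_mul]
        push_cast
        ring

theorem Jtilde_eq (H c s t ε : ℝ) {B : Finset α} {Δ p : Finset (Finset α)}
    (hΔ : IsPartitionOf B Δ) (hΔsing : ∀ b ∈ Δ, #b ≠ 1) (hpair : ∀ q ∈ p, #q = 2) :
    Jtilde H c s t ε B Δ p = ε ^ ((#B : ℝ) / 2) *
      ((∫⋯∫⁻_B, cumulantWeight c (2 * H - 2) (blockOf Δ) B p
        ∂(fun _ => volume.restrict (Set.Icc (s / ε) (t / ε)))) 0).toReal := by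
  have h1 : (Δ.filter fun A => #A = 1) = ∅ := Finset.filter_false_of_mem hΔsing
  have h2 : (Δ.filter fun A => 2 ≤ #A) = Δ := Finset.filter_true_of_mem fun A hA => by
    have := hΔsing A hA
    have := Finset.card_pos.mpr (hΔ.1 A hA)
    omega
  have hext : Measurable fun r : {x // x ∈ B} → ℝ => extendBy B r :=
    measurable_updateFinset (x := fun _ : α => (0 : ℝ))
  rw [Jtilde, h1, h2, volume_pi, Measure.restrict_pi_pi, integral_eq_lintegral_of_nonneg_ae]
  · simp only [Finset.card_empty, Nat.cast_zero, zero_mul, zero_add]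
    congr 2
    refine lintegral_congr fun r => ?_
    have hr : Function.updateFinset (0 : α → ℝ) B r = extendBy B r := rfl
    rw [hr, cumulantWeight, ENNReal.ofReal_mul
      (Finset.prod_nonneg fun _ _ => (Real.exp_pos _).le), ← Real.exp_sum, ← Finset.mul_sum,
      hΔ.sum_sum_eq fun i A => ∑ j ∈ A, |extendBy B r i - extendBy B r j|,
      ENNReal.ofReal_prod_of_nonneg fun q _ => Real.rpow_nonneg (pairGap_nonneg _ q) _]
  · exact Filter.Eventually.of_forall fun r => mul_nonneg
      (Finset.prod_nonneg fun _ _ => (Real.exp_pos _).le)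
      (Finset.prod_nonneg fun q _ => Real.rpow_nonneg (pairGap_nonneg _ q) _)
  · refine Measurable.aestronglyMeasurable (Measurable.mul ?_ ?_)
    · have : ∀ i, Measurable fun r : {x // x ∈ B} → ℝ => extendBy B r i := fun i =>
        (measurable_pi_apply i).comp hext
      fun_prop
    · exact Finset.measurable_prod _ fun q hq =>
        ((measurable_pairGap (hpair q hq)).comp hext).pow_const _

/-- Splitting off the variables in `B \ B'`. -/
theorem cumulantWeight_le_mul {c γ : ℝ} (hc : 0 < c) {N N' : α → Finset α} {B B' : Finset α}
    (hB' : B' ⊆ B) (hN : ∀ i ∈ B', N' i ⊆ N i) (p : Finset (Finset α)) (f : Finset α → Prop)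
    [DecidablePred f] (r : α → ℝ) :
    cumulantWeight c γ N B p r ≤ cumulantWeight c γ N (B \ B') (p.filter fun q => ¬ f q) r *
      cumulantWeight c γ N' B' (p.filter f) r := by
  unfold cumulantWeight
  rw [mul_mul_mul_comm, ← ENNReal.ofReal_mul (Real.exp_pos _).le, ← Real.exp_add,
    mul_comm (∏ q ∈ p.filter fun q => ¬ f q, _), Finset.prod_filter_mul_prod_filter_not]
  gcongr
  rw [← mul_add]
  refine mul_le_mul_of_nonpos_left ?_ (by linarith)
  rw [← Finset.sum_sdiff hB']
  gcongr with i hi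
  exact hN i hi

theorem cumulantWeight_congr {c γ : ℝ} {B : Finset α} {Δ p : Finset (Finset α)}
    (hΔ : IsPartitionOf B Δ) (hp : IsPartitionOf B p) (hpair : ∀ q ∈ p, #q = 2) {x y : α → ℝ}
    (hxy : ∀ i ∈ B, x i = y i) :
    cumulantWeight c γ (blockOf Δ) B p x = cumulantWeight c γ (blockOf Δ) B p y := by
  unfold cumulantWeight
  congr 1
  · refine congrArg (fun z => ENNReal.ofReal (Real.exp (-c * z))) ?_
    refine Finset.sum_congr rfl fun i hi => Finset.sum_congr rfl fun j hj => ?_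
    obtain ⟨A, hA, hiA⟩ := hΔ.exists_mem hi
    rw [hΔ.blockOf_eq hA hiA] at hj
    rw [hxy i hi, hxy j (hΔ.subset hA hj)]
  · refine Finset.prod_congr rfl fun q hq => ?_
    obtain ⟨a, b, -, rfl⟩ := Finset.card_eq_two.mp (hpair q hq)
    have hq' := hp.subset hq
    rw [pairGap_pair, pairGap_pair, hxy a (hq' (by simp)), hxy b (hq' (by simp))]

theorem stmt4 (H c s t : ℝ) (hH : H ∈ Set.Ioo (1 / 2 : ℝ) 1) (hc : 0 < c) (hst : s < t)
    (B B' : Finset α) (hB' : B' ⊆ B)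
    (Δ p : Finset (Finset α))
    (hΔ : IsPartitionOf B Δ) (hΔsing : ∀ b ∈ Δ, b.card ≠ 1)
    (hp : IsPartitionOf B p) (hpair : ∀ b ∈ p, b.card = 2)
    (hconn : ConnectedPair B Δ p)
    (hΔ'sing : ∀ b ∈ restrictPart Δ B', b.card ≠ 1)
    (hpsplit : ∀ q ∈ p, q ⊆ B' ∨ Disjoint q B')
    (hconn' : ConnectedPair B' (restrictPart Δ B') (restrictPart p B')) :
    ∃ C : ℝ, ∀ ε ∈ Set.Ioc (0 : ℝ) 1,
      Jtilde H c s t ε B Δ p ≤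
        C * Jtilde H c s t ε B' (restrictPart Δ B') (restrictPart p B') := by
  obtain ⟨hH1, hH2⟩ := hH
  have hΔ' := hΔ.restrict hB'
  have hp' := hp.restrict hB'
  have hp'eq := restrictPart_eq_filter hp.1 hpsplit
  rw [hp'eq] at hp' ⊢
  set P := p.filter fun q => ¬ q ⊆ B' with hP
  have hpair' : ∀ q ∈ p.filter (· ⊆ B'), #q = 2 := fun q hq => hpair q (Finset.mem_filter.mp hq).1
  have hPpair : ∀ q ∈ P, #q = 2 := fun q hq => hpair q (Finset.mem_filter.mp hq).1
  have hPdisj : (P : Set (Finset α)).PairwiseDisjoint id :=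
    hp.pairwiseDisjoint.subset (Finset.coe_subset.mpr (Finset.filter_subset _ p))
  have hPB' : ∀ q ∈ P, Disjoint q B' := fun q hq => by
    rw [hP, Finset.mem_filter] at hq
    exact (hpsplit q hq.1).resolve_left hq.2
  have hDP : B \ B' = P.biUnion id := by
    ext i
    simp only [Finset.mem_sdiff, Finset.mem_biUnion, id]
    constructor
    · rintro ⟨hi, hi'⟩
      obtain ⟨q, hq, hiq⟩ := hp.exists_mem hi
      exact ⟨q, Finset.mem_filter.mpr ⟨hq, fun h => hi' (h hiq)⟩, hiq⟩
    · rintro ⟨q, hq, hiq⟩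
      exact ⟨hp.subset (Finset.mem_filter.mp hq).1 hiq, Finset.disjoint_left.mp (hPB' q hq) hiq⟩
  have hcard : #B = #B' + 2 * #P := by
    rw [← Finset.card_sdiff_add_card_eq_card hB', hDP,
      Finset.card_biUnion (fun q hq q' hq' h => hPdisj hq hq' h),
      Finset.sum_congr rfl (f := fun q => #(id q)) hPpair]
    simp [mul_comm, add_comm]
  obtain ⟨M, hM, hbound⟩ := exists_lmarginal_cumulantWeight_le (γ := 2 * H - 2) hc (by linarith)
    (by linarith) hst hΔ hΔsing Finset.sdiff_subset hDP hPpair hPdisj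
  obtain ⟨M', hM', hbound'⟩ := exists_lmarginal_cumulantWeight_le (γ := 2 * H - 2) hc (by linarith)
    (by linarith) hst hΔ' hΔ'sing subset_rfl (hp'.2.1.symm.trans (Finset.sup_eq_biUnion _ _)) hpair'
    hp'.pairwiseDisjoint
  refine ⟨M.toReal, fun ε hε => ?_⟩
  have hε0 : 0 < ε := hε.1
  rw [Jtilde_eq H c s t ε hΔ hΔsing hpair, Jtilde_eq H c s t ε hΔ' hΔ'sing hpair']
  set ν : Measure ℝ := volume.restrict (Set.Icc (s / ε) (t / ε)) with hν
  set L' := (∫⋯∫⁻_B', cumulantWeight c (2 * H - 2) (blockOf (restrictPart Δ B')) B'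
    (p.filter (· ⊆ B')) ∂(fun _ => ν)) 0 with hL'
  have hL'top : L' ≠ ⊤ := ne_top_of_le_ne_top (by finiteness) (hbound' ε hε 0)
  have hle : (∫⋯∫⁻_B, cumulantWeight c (2 * H - 2) (blockOf Δ) B p ∂(fun _ => ν)) 0 ≤
      M * ENNReal.ofReal (1 / ε) ^ #P * L' := by
    refine (lmarginal_mono (fun x => cumulantWeight_le_mul hc hB'
      (fun i hi => hΔ.blockOf_restrict_subset hB' hi) p (· ⊆ B') x) 0).trans ?_
    have h := lmarginal_union_mul_le Finset.sdiff_disjoint (measurable_cumulantWeight hPpair)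
      (measurable_cumulantWeight (c := c) (γ := 2 * H - 2) hpair') (hbound ε hε) (fun x y hxy =>
        cumulantWeight_congr hΔ' hp' hpair' fun i hi => hxy i (by simp [hi])) 0
    rwa [Finset.sdiff_union_of_subset hB'] at h
  have hreal := ENNReal.toReal_mono (by finiteness) hle
  rw [ENNReal.toReal_mul, ENNReal.toReal_mul, ENNReal.toReal_pow,
    ENNReal.toReal_ofReal (by positivity)] at hreal
  have hpow : ε ^ ((#B : ℝ) / 2) = ε ^ ((#B' : ℝ) / 2) * ε ^ #P := by
    rw [← Real.rpow_natCast, ← Real.rpow_add hε0, hcard]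
    congr 1
    push_cast
    ring
  calc _ ≤ ε ^ ((#B : ℝ) / 2) * (M.toReal * (1 / ε) ^ #P * L'.toReal) := by gcongr
    _ = _ := by
        rw [hpow, one_div, inv_pow]
        field_simp
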